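/- Let α≥2 and δ≥0, and suppose the initial positions satisfy |x_i(0)−x_j(0)|>δ for all i≠j. Then the δ-Cucker–Smale system admits a global smooth solution (the maximal life-span is infinite), and along the solution the interparticle distances satisfy |x_i(t)−x_j(t)|>δ for all i≠j and all t≥0. -/

import Mathlib

open Set Filter Topology Metric

theorem cs_local {E : Type*} [NormedAddCommGroup E] [NormedSpace ℝ E] [CompleteSpace E]
    (f : E → E) (Ω : Set E) (y : E) (hΩ : Ω ∈ 𝓝 y) (hf : ContDiffAt ℝ 1 f y) :
    ∃ U ∈ 𝓝 y, ∃ ε > (0 : ℝ), ∀ z ∈ U, ∃ β : ℝ → E, β 0 = z ∧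
      ∀ t ∈ Icc (0 : ℝ) ε, HasDerivAt β (f (β t)) t ∧ β t ∈ Ω := by
  have ⟨ε, hε, a, r, _, _, hr, hpl⟩ := IsPicardLindelof.of_contDiffAt_one hf
  obtain ⟨α, hα, hc⟩ := (hpl 0).exists_forall_mem_closedBall_eq_hasDerivWithinAt_continuousOn
  have hr' : (0 : ℝ) < r := hr
  have hc0 : ContinuousAt α (y, 0) := by
    apply hc.continuousAt
    apply prod_mem_nhds
    · exact closedBall_mem_nhds _ hr'
    · exact Icc_mem_nhds (by linarith) (by linarith)
  have hy0 : α (y, 0) = y := (hα y (mem_closedBall_self hr'.le)).1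
  have hev : ∀ᶠ p in 𝓝 (y, (0 : ℝ)), α p ∈ Ω := by
    apply hc0
    rw [hy0]; exact hΩ
  rw [nhds_prod_eq] at hev
  obtain ⟨P, hP, Q, hQ, hPQ⟩ := eventually_prod_iff.1 hev
  obtain ⟨η, hη, hball⟩ := Metric.eventually_nhds_iff.1 hQ
  refine ⟨{z | P z} ∩ closedBall y r, inter_mem hP (closedBall_mem_nhds _ hr'),
    min (η / 2) (ε / 2), by positivity, ?_⟩
  rintro z ⟨hz, hzr⟩
  refine ⟨fun t => α (z, t), (hα z hzr).1, ?_⟩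
  rintro t ⟨ht0, ht1⟩
  have h1 := le_trans ht1 (min_le_left _ _)
  have h2 := le_trans ht1 (min_le_right _ _)
  constructor
  · refine ((hα z hzr).2 t ⟨by linarith, by linarith⟩).hasDerivAt ?_
    exact Icc_mem_nhds (by linarith) (by linarith)
  · apply hPQ hz
    apply hball
    rw [Real.dist_eq, sub_zero, abs_of_nonneg ht0]; linarith

theorem cs_uniform {E : Type*} [NormedAddCommGroup E] [NormedSpace ℝ E] [CompleteSpace E]
    (f : E → E) (Ω : Set E) (hΩ : IsOpen Ω) (hf : ∀ y ∈ Ω, ContDiffAt ℝ 1 f y)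
    (K : Set E) (hK : IsCompact K) (hKΩ : K ⊆ Ω) :
    ∃ ε > (0 : ℝ), ∀ z ∈ K, ∃ β : ℝ → E, β 0 = z ∧
      ∀ t ∈ Icc (0 : ℝ) ε, HasDerivAt β (f (β t)) t ∧ β t ∈ Ω := by
  refine hK.induction_on (p := fun s => ∃ ε > (0 : ℝ), ∀ z ∈ s, ∃ β : ℝ → E, β 0 = z ∧
      ∀ t ∈ Icc (0 : ℝ) ε, HasDerivAt β (f (β t)) t ∧ β t ∈ Ω) ?_ ?_ ?_ ?_
  · exact ⟨1, one_pos, by simp⟩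
  · rintro s t hst ⟨ε, hε, h⟩
    exact ⟨ε, hε, fun z hz => h z (hst hz)⟩
  · rintro s t ⟨ε, hε, h⟩ ⟨ε', hε', h'⟩
    refine ⟨min ε ε', lt_min hε hε', ?_⟩
    rintro z (hz | hz)
    · obtain ⟨β, h0, hb⟩ := h z hz
      exact ⟨β, h0, fun t ht => hb t ⟨ht.1, ht.2.trans (min_le_left _ _)⟩⟩
    · obtain ⟨β, h0, hb⟩ := h' z hz
      exact ⟨β, h0, fun t ht => hb t ⟨ht.1, ht.2.trans (min_le_right _ _)⟩⟩
  · intro y hy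
    obtain ⟨U, hU, ε, hε, h⟩ := cs_local f Ω y (hΩ.mem_nhds (hKΩ hy)) (hf y (hKΩ hy))
    exact ⟨U, mem_nhdsWithin_of_mem_nhds hU, ε, hε, h⟩

def CSSol {E : Type*} [NormedAddCommGroup E] [NormedSpace ℝ E]
    (f : E → E) (Ω : Set E) (y₀ : E) (S : ℝ) (γ : ℝ → E) : Prop :=
  γ 0 = y₀ ∧ ∀ t ∈ Icc (0 : ℝ) S, HasDerivAt γ (f (γ t)) t ∧ γ t ∈ Ω

theorem cs_step {E : Type*} [NormedAddCommGroup E] [NormedSpace ℝ E]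
    (f : E → E) (Ω : Set E) (y₀ : E) (S : ℝ) (hS : 0 ≤ S) (γ : ℝ → E) (hγ : CSSol f Ω y₀ S γ)
    (ε : ℝ) (β : ℝ → E) (hε : 0 < ε) (hβ0 : β 0 = γ S)
    (hβ : ∀ t ∈ Icc (0 : ℝ) ε, HasDerivAt β (f (β t)) t ∧ β t ∈ Ω) :
    ∃ γ', CSSol f Ω y₀ (S + ε) γ' ∧ EqOn γ' γ (Iic S) := by
  classical
  set γ' : ℝ → E := fun t => if t ≤ S then γ t else β (t - S) with hγ'
  have e1 : EqOn γ' γ (Iic S) := fun t ht => by simp only [hγ']; exact if_pos ht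
  have e2 : EqOn γ' (fun t => β (t - S)) (Ici S) := by
    intro t ht
    rcases eq_or_lt_of_le (show S ≤ t from ht) with rfl | h
    · simp [hγ', hβ0]
    · simp only [hγ']; exact if_neg (not_le.2 h)
  refine ⟨γ', ⟨by rw [e1 hS]; exact hγ.1, ?_⟩, e1⟩
  have hd : ∀ t, 0 ≤ t - S → t - S ≤ ε → HasDerivAt (fun t => β (t - S)) (f (β (t - S))) t := by
    intro t h1 h2
    exact (hβ (t - S) ⟨h1, h2⟩).1.comp_sub_const t S
  rintro t ⟨ht0, ht1⟩
  rcases lt_trichotomy t S with h | h | h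
  · have hg := hγ.2 t ⟨ht0, h.le⟩
    rw [e1 (show t ∈ Iic S from h.le)]
    refine ⟨hg.1.congr_of_eventuallyEq ?_, hg.2⟩
    exact e1.eventuallyEq_of_mem (Iic_mem_nhds h)
  · subst h
    have hg := hγ.2 t ⟨ht0, le_rfl⟩
    have e3 := e1 (self_mem_Iic : t ∈ Iic t)
    rw [e3]
    refine ⟨?_, hg.2⟩
    have hl : HasDerivWithinAt γ' (f (γ t)) (Iic t) t :=
      hg.1.hasDerivWithinAt.congr e1 e3
    have hr : HasDerivWithinAt γ' (f (γ t)) (Ici t) t := by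
      have := (hd t (by simp) (by simpa using hε.le)).hasDerivWithinAt (s := Ici t)
      rw [sub_self, hβ0] at this
      exact this.congr e2 (e2 self_mem_Ici)
    have := hl.union hr
    rwa [Iic_union_Ici, hasDerivWithinAt_univ] at this
  · have e3 := e2 (show t ∈ Ici S from h.le)
    rw [e3]
    refine ⟨(hd t (by linarith) (by linarith)).congr_of_eventuallyEq ?_,
      (hβ (t - S) ⟨by linarith, by linarith⟩).2⟩
    exact e2.eventuallyEq_of_mem (Ici_mem_nhds h)

theorem cs_global {E : Type*} [NormedAddCommGroup E] [NormedSpace ℝ E] [CompleteSpace E]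
    (f : E → E) (Ω : Set E) (hΩ : IsOpen Ω) (hf : ∀ y ∈ Ω, ContDiffAt ℝ 1 f y)
    (y₀ : E) (hy₀ : y₀ ∈ Ω)
    (hK : ∀ T : ℝ, ∃ K : Set E, IsCompact K ∧ K ⊆ Ω ∧
      ∀ S γ, 0 ≤ S → S ≤ T → CSSol f Ω y₀ S γ → γ S ∈ K) :
    ∃ γ : ℝ → E, γ 0 = y₀ ∧ ∀ t, 0 ≤ t → HasDerivAt γ (f (γ t)) t ∧ γ t ∈ Ω := by
  have start : ∃ γ, CSSol f Ω y₀ ((0 : ℕ) : ℝ) γ := by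
    obtain ⟨U, hU, ε, hε, h⟩ := cs_local f Ω y₀ (hΩ.mem_nhds hy₀) (hf y₀ hy₀)
    obtain ⟨β, h0, hb⟩ := h y₀ (mem_of_mem_nhds hU)
    exact ⟨β, h0, fun t ht => hb t ⟨ht.1, ht.2.trans (by simpa using hε.le)⟩⟩
  have ext : ∀ (n : ℕ) (γ : ℝ → E), CSSol f Ω y₀ (n : ℝ) γ →
      ∃ γ', CSSol f Ω y₀ ((n + 1 : ℕ) : ℝ) γ' ∧ EqOn γ' γ (Iic (n : ℝ)) := by
    intro n γ hγ
    obtain ⟨K, hKc, hKΩ, hKS⟩ := hK (n + 1)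
    obtain ⟨ε, hε, hu⟩ := cs_uniform f Ω hΩ hf K hKc hKΩ
    have key : ∀ k : ℕ, ∃ S' γ', (n : ℝ) ≤ S' ∧ min ((n : ℝ) + k * ε) (n + 1) ≤ S' ∧
        CSSol f Ω y₀ S' γ' ∧ EqOn γ' γ (Iic (n : ℝ)) := by
      intro k
      induction k with
      | zero => exact ⟨n, γ, le_rfl, by simp, hγ, fun _ _ => rfl⟩
      | succ k ih =>
        obtain ⟨S', γ', h1, h2, h3, h4⟩ := ih
        have hn : (0 : ℝ) ≤ n := n.cast_nonneg
        by_cases hS : S' ≤ n + 1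
        · obtain ⟨β, hb0, hb⟩ := hu _ (hKS S' γ' (hn.trans h1) hS h3)
          obtain ⟨γ'', h5, h6⟩ := cs_step f Ω y₀ S' (hn.trans h1) γ' h3 ε β hε hb0 hb
          refine ⟨S' + ε, γ'', by linarith, ?_, h5,
            fun t ht => (h6 (le_trans (show t ≤ n from ht) h1)).trans (h4 ht)⟩
          push_cast
          rcases min_le_iff.1 h2 with h | h
          · exact (min_le_left _ _).trans (by linarith)
          · exact (min_le_right _ _).trans (by linarith)
        · exact ⟨S', γ', h1, (min_le_right _ _).trans (by linarith), h3, h4⟩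
    obtain ⟨k, hk⟩ := exists_nat_ge (1 / ε)
    obtain ⟨S', γ', h1, h2, h3, h4⟩ := key k
    have : 1 ≤ k * ε := by rwa [div_le_iff₀ hε] at hk
    rw [min_eq_right (by linarith)] at h2
    exact ⟨γ', ⟨h3.1, fun t ht => h3.2 t ⟨ht.1, ht.2.trans (by push_cast; exact h2)⟩⟩, h4⟩
  obtain ⟨γ₀, hγ₀⟩ := start
  choose! F hF using ext
  let g : ℕ → ℝ → E := fun n => Nat.rec γ₀ (fun n γ => F n γ) n
  have hg : ∀ n : ℕ, CSSol f Ω y₀ (n : ℝ) (g n) := by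
    intro n
    induction n with
    | zero => exact hγ₀
    | succ n ih => exact (hF n _ ih).1
  have hgs : ∀ n, EqOn (g (n + 1)) (g n) (Iic (n : ℝ)) := fun n => (hF n _ (hg n)).2
  have hgm : ∀ n m, n ≤ m → EqOn (g m) (g n) (Iic (n : ℝ)) := by
    intro n m h
    induction m, h using Nat.le_induction with
    | base => exact fun _ _ => rfl
    | succ m hm ih =>
      intro t ht
      rw [hgs m (le_trans (show t ≤ n from ht) (by exact_mod_cast hm)), ih ht]
  let γ : ℝ → E := fun t => g ⌈t⌉₊ t
  have hγ : ∀ n : ℕ, EqOn γ (g n) (Iic (n : ℝ)) := by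
    intro n t ht
    exact (hgm _ n (Nat.ceil_le.2 ht) (Nat.le_ceil t)).symm
  refine ⟨γ, ?_, ?_⟩
  · rw [hγ 0 (by simp)]; exact hγ₀.1
  · intro t ht
    obtain ⟨n, hn⟩ := exists_nat_gt t
    rw [hγ n hn.le]
    have := (hg n).2 t ⟨ht, hn.le⟩
    exact ⟨this.1.congr_of_eventuallyEq ((hγ n).eventuallyEq_of_mem (Iic_mem_nhds hn)), this.2⟩

abbrev CSPhase (N d : ℕ) : Type :=
  (Fin N → EuclideanSpace ℝ (Fin d)) × (Fin N → EuclideanSpace ℝ (Fin d))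

noncomputable def csField (N d : ℕ) (α δ : ℝ) (p : CSPhase N d) : CSPhase N d :=
  (p.2, fun i => (N : ℝ)⁻¹ • ∑ j ∈ Finset.univ.erase i,
          ((‖p.1 i - p.1 j‖ - δ) ^ (-α)) • (p.2 j - p.2 i))

def csDom (N d : ℕ) (δ : ℝ) : Set (CSPhase N d) :=
  {p | ∀ i j : Fin N, i ≠ j → δ < ‖p.1 i - p.1 j‖}

theorem csDom_open (N d : ℕ) (δ : ℝ) : IsOpen (csDom N d δ) := by
  simp only [csDom, ofPred_forall]
  refine isOpen_iInter_of_finite fun i => isOpen_iInter_of_finite fun j =>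
    isOpen_iInter_of_finite fun _ => ?_
  exact isOpen_lt (by fun_prop) (by fun_prop)

theorem csField_contDiffAt (N d : ℕ) (α δ : ℝ) (hδ : 0 ≤ δ) (y : CSPhase N d)
    (hy : y ∈ csDom N d δ) : ContDiffAt ℝ 1 (csField N d α δ) y := by
  have h1 : ∀ i, ContDiffAt ℝ 1 (fun p : CSPhase N d => p.1 i) y := by
    intro i
    exact contDiffAt_pi.1 contDiffAt_fst i
  have h2 : ∀ i, ContDiffAt ℝ 1 (fun p : CSPhase N d => p.2 i) y := by
    intro i
    exact contDiffAt_pi.1 contDiffAt_snd i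
  unfold csField
  refine contDiffAt_snd.prodMk (contDiffAt_pi.2 fun i => ContDiffAt.const_smul _
    (ContDiffAt.sum fun j hj => ?_))
  have hij : i ≠ j := (Finset.ne_of_mem_erase hj).symm
  have hd := hy i j hij
  have hne : y.1 i - y.1 j ≠ 0 := norm_pos_iff.1 (hδ.trans_lt hd)
  have hA : ContDiffAt ℝ 1 (fun p : CSPhase N d => (‖p.1 i - p.1 j‖ - δ) ^ (-α)) y := by
    exact ContDiffAt.rpow_const_of_ne (((h1 i).sub (h1 j)).norm ℝ hne |>.sub contDiffAt_const)
      (sub_pos.2 hd).ne'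
  exact hA.smul ((h2 j).sub (h2 i))

theorem cs_fst {E F : Type*} [NormedAddCommGroup E] [NormedSpace ℝ E] [NormedAddCommGroup F]
    [NormedSpace ℝ F] {γ : ℝ → E × F} {γ' : E × F} {t : ℝ} (h : HasDerivAt γ γ' t) :
    HasDerivAt (fun s => (γ s).1) γ'.1 t :=
  (hasFDerivAt_fst (𝕜 := ℝ) (p := γ t)).comp_hasDerivAt t h

theorem cs_snd {E F : Type*} [NormedAddCommGroup E] [NormedSpace ℝ E] [NormedAddCommGroup F]
    [NormedSpace ℝ F] {γ : ℝ → E × F} {γ' : E × F} {t : ℝ} (h : HasDerivAt γ γ' t) :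
    HasDerivAt (fun s => (γ s).2) γ'.2 t :=
  (hasFDerivAt_snd (𝕜 := ℝ) (p := γ t)).comp_hasDerivAt t h

theorem cs_antitone (S : ℝ) (hS : 0 ≤ S) (g g' : ℝ → ℝ)
    (hg : ∀ t ∈ Icc (0 : ℝ) S, HasDerivAt g (g' t) t) (h : ∀ t ∈ Icc (0 : ℝ) S, g' t ≤ 0) :
    ∀ t ∈ Icc (0 : ℝ) S, g t ≤ g 0 := by
  have : AntitoneOn g (Icc 0 S) := by
    apply antitoneOn_of_hasDerivWithinAt_nonpos (convex_Icc 0 S) (f' := g')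
    · exact fun t ht => (hg t ht).continuousAt.continuousWithinAt
    · exact fun t ht => (hg t (interior_subset ht)).hasDerivWithinAt
    · exact fun t ht => h t (interior_subset ht)
  exact fun t ht => this ⟨le_rfl, hS⟩ ht ht.1

/-- symmetrization of the dissipation -/
theorem cs_dissip {V : Type*} [NormedAddCommGroup V] [InnerProductSpace ℝ V] (N : ℕ)
    (w : Fin N → Fin N → ℝ) (hw : ∀ i j, w i j = w j i) (v : Fin N → V) :
    ∑ i, 2 * inner ℝ (v i) ((N : ℝ)⁻¹ • ∑ j ∈ Finset.univ.erase i, w i j • (v j - v i))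
      = - (N : ℝ)⁻¹ * ∑ i, ∑ j, w i j * ‖v i - v j‖ ^ 2 := by
  have h1 : ∀ i, ∑ j ∈ Finset.univ.erase i, w i j • (v j - v i) = ∑ j, w i j • (v j - v i) :=
    fun i => Finset.sum_erase _ (by simp)
  simp only [h1, inner_smul_right, inner_sum, ← Finset.mul_sum, mul_left_comm (2 : ℝ)]
  rw [neg_mul, ← mul_neg]
  congr 1
  have h2 : ∑ i, ∑ j, w i j * inner ℝ (v i) (v j - v i)
      = ∑ i, ∑ j, w i j * inner ℝ (v j) (v i - v j) := by
    rw [Finset.sum_comm]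
    refine Finset.sum_congr rfl fun i _ => Finset.sum_congr rfl fun j _ => ?_
    rw [hw]
  rw [two_mul]
  nth_rewrite 2 [h2]
  simp only [← Finset.sum_add_distrib, ← Finset.sum_neg_distrib]
  refine Finset.sum_congr rfl fun i _ => Finset.sum_congr rfl fun j _ => ?_
  rw [norm_sub_sq_real, inner_sub_right, inner_sub_right, real_inner_self_eq_norm_sq,
    real_inner_self_eq_norm_sq, real_inner_comm (v i) (v j)]
  ring

theorem cs_scalar (s α q a : ℝ) (hs : 0 < s) (hα : 2 ≤ α) (ha : |a| ≤ q) :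
    -(a / s) ≤ 1 / 2 + 1 / 2 * (s ^ (-α) * q ^ 2) + 1 / 2 * q ^ 2 := by
  have hq : 0 ≤ q := (abs_nonneg a).trans ha
  have h1 : -(a / s) ≤ q / s := by
    rw [← neg_div]
    gcongr
    exact (neg_le_abs a).trans ha
  have h2 : (q / s) ^ 2 ≤ s ^ (-α) * q ^ 2 + q ^ 2 := by
    have e : (q / s) ^ 2 = s ^ (-2 : ℝ) * q ^ 2 := by
      rw [Real.rpow_neg hs.le, Real.rpow_two]; field_simp
    have : s ^ (-2 : ℝ) ≤ s ^ (-α) + 1 := by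
      rcases le_total s 1 with h | h
      · have := Real.rpow_le_rpow_of_exponent_ge hs h (show -α ≤ -2 by linarith)
        linarith
      · have := Real.rpow_le_one_of_one_le_of_nonpos h (show (-2 : ℝ) ≤ 0 by norm_num)
        have := Real.rpow_nonneg hs.le (-α)
        linarith
    rw [e]
    nlinarith [sq_nonneg q]
  nlinarith [sq_nonneg (q / s - 1)]

set_option maxHeartbeats 600000 in
theorem cs_apriori (N d : ℕ) (hN : 0 < N) (α δ : ℝ) (hα : 2 ≤ α) (hδ : 0 ≤ δ)
    (y₀ : CSPhase N d) (T : ℝ) :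
    ∃ K : Set (CSPhase N d), IsCompact K ∧ K ⊆ csDom N d δ ∧
      ∀ S γ, 0 ≤ S → S ≤ T → CSSol (csField N d α δ) (csDom N d δ) y₀ S γ → γ S ∈ K := by
  classical
  set E0 : ℝ := ∑ i, ‖y₀.2 i‖ ^ 2 with hE0
  have hE0n : 0 ≤ E0 := by positivity
  set M : ℝ := ∑ i, ∑ j, |Real.log (‖y₀.1 i - y₀.1 j‖ - δ)| + N / 2 * E0 + (1 / 2 + E0) * |T|
    with hM
  set R : ℝ := ‖y₀‖ + Real.sqrt E0 * |T| + Real.sqrt E0 with hR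
  refine ⟨closedBall 0 R ∩ {p | ∀ i j : Fin N, i ≠ j → δ + Real.exp (-M) ≤ ‖p.1 i - p.1 j‖},
    ?_, ?_, ?_⟩
  · apply (isCompact_closedBall _ _).inter_right
    simp only [ofPred_forall]
    refine isClosed_iInter fun i => isClosed_iInter fun j => isClosed_iInter fun _ => ?_
    exact isClosed_le (by fun_prop) (by fun_prop)
  · rintro p ⟨-, hp⟩ i j hij
    linarith [hp i j hij, Real.exp_pos (-M)]
  intro S γ hS hST hγ
  have hT : S ≤ |T| := hST.trans (le_abs_self T)
  have hx : ∀ i, ∀ t ∈ Icc 0 S, HasDerivAt (fun s => (γ s).1 i) ((γ t).2 i) t := by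
    intro i t ht
    have := (hγ.2 t ht).1
    have h1 : HasDerivAt (fun s => (γ s).1) ((csField N d α δ (γ t)).1) t := by
      exact cs_fst (this)
    exact hasDerivAt_pi.1 h1 i
  have hv : ∀ i, ∀ t ∈ Icc 0 S, HasDerivAt (fun s => (γ s).2 i)
      ((csField N d α δ (γ t)).2 i) t := by
    intro i t ht
    have := (hγ.2 t ht).1
    have h1 : HasDerivAt (fun s => (γ s).2) ((csField N d α δ (γ t)).2) t := by
      exact cs_snd (this)
    exact hasDerivAt_pi.1 h1 i
  set w : ℝ → Fin N → Fin N → ℝ := fun t i j =>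
    if i = j then 0 else (‖(γ t).1 i - (γ t).1 j‖ - δ) ^ (-α) with hw
  have hwsymm : ∀ t i j, w t i j = w t j i := by
    intro t i j
    simp only [hw, eq_comm (a := i), norm_sub_rev ((γ t).1 i)]
  have hwnn : ∀ t ∈ Icc 0 S, ∀ i j, 0 ≤ w t i j := by
    intro t ht i j
    by_cases h : i = j
    · simp [hw, h]
    · simp only [hw, if_neg h]
      exact Real.rpow_nonneg (sub_nonneg.2 ((hγ.2 t ht).2 i j h).le) _
  set D : ℝ → ℝ := fun t => ∑ i, ∑ j, w t i j * ‖(γ t).2 i - (γ t).2 j‖ ^ 2 with hD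
  have hDnn : ∀ t ∈ Icc 0 S, 0 ≤ D t := fun t ht =>
    Finset.sum_nonneg fun i _ => Finset.sum_nonneg fun j _ =>
      mul_nonneg (hwnn t ht i j) (sq_nonneg _)
  set En : ℝ → ℝ := fun t => ∑ i, ‖(γ t).2 i‖ ^ 2 with hEn
  have hEnD : ∀ t ∈ Icc 0 S, HasDerivAt En (-(N : ℝ)⁻¹ * D t) t := by
    intro t ht
    have h1 := HasDerivAt.fun_sum (u := Finset.univ) (fun i _ => (hv i t ht).norm_sq)
    have h2 := cs_dissip N (w t) (hwsymm t) (γ t).2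
    rw [← h2]
    refine h1.congr_deriv ?_
    refine Finset.sum_congr rfl fun i _ => ?_
    simp only [csField]
    congr 3
    refine Finset.sum_congr rfl fun j hj => ?_
    simp only [hw, if_neg (Finset.ne_of_mem_erase hj).symm]
  have hNi : (0 : ℝ) < (N : ℝ)⁻¹ := by positivity
  have hEn0 : En 0 = E0 := by simp [hEn, hE0, hγ.1]
  have hEnle : ∀ t ∈ Icc 0 S, En t ≤ E0 := by
    rw [← hEn0]
    apply cs_antitone S hS En _ hEnD
    intro t ht
    have := mul_nonneg hNi.le (hDnn t ht)
    linarith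
  have hvsq : ∀ t ∈ Icc 0 S, ∀ i, ‖(γ t).2 i‖ ^ 2 ≤ E0 := fun t ht i =>
    (Finset.single_le_sum (f := fun i => ‖(γ t).2 i‖ ^ 2) (fun i _ => sq_nonneg _)
      (Finset.mem_univ i)).trans (hEnle t ht)
  have hvle : ∀ t ∈ Icc 0 S, ∀ i, ‖(γ t).2 i‖ ≤ Real.sqrt E0 := fun t ht i =>
    Real.le_sqrt_of_sq_le (hvsq t ht i)
  have hSS : S ∈ Icc 0 S := ⟨hS, le_rfl⟩
  have hsq := Real.sqrt_nonneg E0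
  have hR0 : 0 ≤ R := by positivity
  refine ⟨?_, ?_⟩
  · rw [mem_closedBall_zero_iff, Prod.norm_def]
    apply max_le
    · rw [pi_norm_le_iff_of_nonneg hR0]
      intro i
      have h1 := norm_image_sub_le_of_norm_deriv_le_segment' (f := fun s => (γ s).1 i)
        (fun t ht => (hx i t ht).hasDerivWithinAt)
        (fun t ht => hvle t (Ico_subset_Icc_self ht) i) S hSS
      simp only [hγ.1, sub_zero] at h1
      have h2 : ‖y₀.1 i‖ ≤ ‖y₀‖ := (norm_le_pi_norm _ i).trans (norm_fst_le y₀)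
      have h3 : Real.sqrt E0 * S ≤ Real.sqrt E0 * |T| := by gcongr
      have h4 := norm_le_norm_sub_add ((γ S).1 i) (y₀.1 i)
      linarith
    · rw [pi_norm_le_iff_of_nonneg hR0]
      intro i
      have := hvle S hSS i
      have h2 : 0 ≤ ‖y₀‖ + Real.sqrt E0 * |T| := by positivity
      linarith
  intro i j hij
  set r : ℝ → ℝ := fun t => ‖(γ t).1 i - (γ t).1 j‖ with hr
  have hrpos : ∀ t ∈ Icc 0 S, 0 < r t - δ := fun t ht => sub_pos.2 ((hγ.2 t ht).2 i j hij)
  have hrd : ∀ t ∈ Icc 0 S, ∃ a, HasDerivAt r a t ∧ |a| ≤ ‖(γ t).2 i - (γ t).2 j‖ := by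
    intro t ht
    have hz := (hx i t ht).sub (hx j t ht)
    have hrt : 0 < r t := by linarith [hrpos t ht]
    have h1 := hz.norm_sq.sqrt (pow_ne_zero 2 hrt.ne')
    refine ⟨_, h1.congr_of_eventuallyEq (Eventually.of_forall fun s => ?_), ?_⟩
    · simp [hr]
    · simp only [Pi.sub_apply, Real.sqrt_sq (norm_nonneg _)]
      change |_ / (2 * r t)| ≤ _
      rw [abs_div, abs_of_pos (show 0 < 2 * r t by linarith), div_le_iff₀ (by linarith), abs_mul,
        abs_two]
      have := abs_real_inner_le_norm ((γ t).1 i - (γ t).1 j) ((γ t).2 i - (γ t).2 j)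
      change _ ≤ r t * _ at this
      linarith
  choose! a ha ha' using hrd
  have hG := cs_antitone S hS
    (fun t => -Real.log (r t - δ) + N / 2 * En t - (1 / 2 + E0) * t)
    (fun t => -(a t / (r t - δ)) + N / 2 * (-(N : ℝ)⁻¹ * D t) - (1 / 2 + E0) * 1)
    (fun t ht => (((((ha t ht).sub_const δ).log (hrpos t ht).ne').neg).add
      ((hEnD t ht).const_mul _)).sub ((hasDerivAt_id t).const_mul _))
    (by
      intro t ht
      have h1 := cs_scalar (r t - δ) α _ _ (hrpos t ht) hα (ha' t ht)
      have h2 : (N : ℝ) / 2 * (-(N : ℝ)⁻¹ * D t) = - (1 / 2) * D t := by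
        have : (N : ℝ) ≠ 0 := by positivity
        field_simp
      have h3 : (r t - δ) ^ (-α) * ‖(γ t).2 i - (γ t).2 j‖ ^ 2 ≤ D t := by
        have e1 : (r t - δ) ^ (-α) = w t i j := by simp only [hw, if_neg hij, hr]
        rw [e1]
        have e2 := Finset.single_le_sum
          (f := fun j => w t i j * ‖(γ t).2 i - (γ t).2 j‖ ^ 2)
          (fun j _ => mul_nonneg (hwnn t ht i j) (sq_nonneg _)) (Finset.mem_univ j)
        have e3 := Finset.single_le_sum
          (f := fun i => ∑ j, w t i j * ‖(γ t).2 i - (γ t).2 j‖ ^ 2)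
          (fun i _ => Finset.sum_nonneg fun j _ =>
            mul_nonneg (hwnn t ht i j) (sq_nonneg _)) (Finset.mem_univ i)
        exact e2.trans e3
      have h4 : ‖(γ t).2 i - (γ t).2 j‖ ^ 2 ≤ 2 * E0 := by
        have e1 : ‖(γ t).2 i‖ ^ 2 + ‖(γ t).2 j‖ ^ 2 ≤ E0 := by
          refine le_trans ?_ (hEnle t ht)
          have := Finset.sum_le_sum_of_subset_of_nonneg (f := fun i => ‖(γ t).2 i‖ ^ 2)
            (Finset.subset_univ {i, j}) (fun i _ _ => sq_nonneg _)
          rwa [Finset.sum_pair hij] at this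
        have e2 := norm_sub_le ((γ t).2 i) ((γ t).2 j)
        have e3 := norm_nonneg ((γ t).2 i - (γ t).2 j)
        nlinarith [sq_nonneg (‖(γ t).2 i‖ - ‖(γ t).2 j‖)]
      rw [h2]
      linarith) S hSS
  simp only [hEn0, mul_zero, sub_zero] at hG
  have hr0 : r 0 = ‖y₀.1 i - y₀.1 j‖ := by simp [hr, hγ.1]
  have hlog0 : -Real.log (r 0 - δ) ≤ ∑ i, ∑ j, |Real.log (‖y₀.1 i - y₀.1 j‖ - δ)| := by
    rw [hr0]
    have e2 := Finset.single_le_sum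
      (f := fun j => |Real.log (‖y₀.1 i - y₀.1 j‖ - δ)|)
      (fun j _ => abs_nonneg _) (Finset.mem_univ j)
    have e3 := Finset.single_le_sum
      (f := fun i => ∑ j, |Real.log (‖y₀.1 i - y₀.1 j‖ - δ)|)
      (fun i _ => Finset.sum_nonneg fun j _ => abs_nonneg _) (Finset.mem_univ i)
    exact (neg_le_abs _).trans (e2.trans e3)
  have hEnS : 0 ≤ (N : ℝ) / 2 * En S :=
    mul_nonneg (by positivity) (Finset.sum_nonneg fun i _ => sq_nonneg _)
  have hTS : (1 / 2 + E0) * S ≤ (1 / 2 + E0) * |T| :=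
    mul_le_mul_of_nonneg_left hT (by linarith)
  have hfin : -M ≤ Real.log (r S - δ) := by
    rw [hM]; linarith
  have := (Real.le_log_iff_exp_le (hrpos S hSS)).1 hfin
  change _ ≤ r S
  linarith

/-- Let `α ≥ 2` and `δ ≥ 0`, and suppose the initial positions satisfy
`‖x_i(0) − x_j(0)‖ > δ` for all `i ≠ j`.  Then the `δ`-Cucker–Smale system (with communication
weight `ψ_δ(s) = (s − δ)^(-α)`, the diagonal terms being interpreted as `0`) admits a global
smooth solution, and along the solution the interparticle distances satisfy
`‖x_i(t) − x_j(t)‖ > δ` for all `i ≠ j` and all `t ≥ 0`. -/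
theorem delta_cucker_smale_global_existence
    (d N : ℕ) (hN : 0 < N) (α δ : ℝ) (hα : 2 ≤ α) (hδ : 0 ≤ δ)
    (x₀ v₀ : Fin N → EuclideanSpace ℝ (Fin d))
    (hsep0 : ∀ i j : Fin N, i ≠ j → δ < ‖x₀ i - x₀ j‖) :
    ∃ x v : ℝ → Fin N → EuclideanSpace ℝ (Fin d),
      x 0 = x₀ ∧ v 0 = v₀ ∧
      (∀ i, ∀ t : ℝ, 0 ≤ t → HasDerivAt (fun s => x s i) (v t i) t) ∧
      (∀ i, ∀ t : ℝ, 0 ≤ t → HasDerivAt (fun s => v s i)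
        ((N : ℝ)⁻¹ • ∑ j ∈ Finset.univ.erase i,
          ((‖x t i - x t j‖ - δ) ^ (-α)) • (v t j - v t i)) t) ∧
      (∀ t : ℝ, 0 ≤ t → ∀ i j : Fin N, i ≠ j → δ < ‖x t i - x t j‖) := by
  obtain ⟨γ, h0, hγ⟩ := cs_global (csField N d α δ) (csDom N d δ) (csDom_open N d δ)
    (csField_contDiffAt N d α δ hδ) (x₀, v₀) hsep0 (cs_apriori N d hN α δ hα hδ (x₀, v₀))
  refine ⟨fun t => (γ t).1, fun t => (γ t).2, by simp [h0], by simp [h0], ?_, ?_, ?_⟩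
  · intro i t ht
    have h1 : HasDerivAt (fun s => (γ s).1) ((csField N d α δ (γ t)).1) t := by
      exact cs_fst ((hγ t ht).1)
    exact hasDerivAt_pi.1 h1 i
  · intro i t ht
    have h1 : HasDerivAt (fun s => (γ s).2) ((csField N d α δ (γ t)).2) t := by
      exact cs_snd ((hγ t ht).1)
    exact hasDerivAt_pi.1 h1 i
  · intro t ht
    exact (hγ t ht).2
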